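/- Let p₂ > 3 be a prime with p₂ ≡ 2 (mod 3), set q₂ = (p₂ − 2)/3 (which is odd), and let p₃ be a prime with p₃ > 3p₂ and p₃ ≡ 2 (mod 3p₂). Let i = 3u with i < p₂ − 1. Then hw(f_{3p₂,p₃,i,0}) = 8u + 6 if 0 ≤ u ≤ (q₂ − 1)/2, and hw(f_{3p₂,p₃,i,0}) = 4u + 2q₂ + 5 if (q₂ + 1)/2 ≤ u ≤ q₂ − 1. -/

import Mathlib

open Polynomial

/-- The Hamming weight of a polynomial: its number of nonzero coefficients. -/
noncomputable def hw (f : Polynomial ℤ) : ℕ := f.support.card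

/-- The block `f_{m,p,i,0}`: the polynomial of degree `< m` whose coefficient of `x^k`
is the coefficient of `x^(i*p + k)` in `Φ_{mp}`, for `0 ≤ k < m`. -/
noncomputable def blockPoly (m p i : ℕ) : Polynomial ℤ :=
  ∑ k ∈ Finset.range m, C ((cyclotomic (m * p) ℤ).coeff (i * p + k)) * X ^ k

/-- One period of the power series `1 / Φ_{3p}`. -/
def wPer (p r : ℕ) : ℤ := (if r < 3 then 1 else 0) - (if p ≤ r ∧ r < p + 3 then 1 else 0)

/-- The power series `1 / Φ_{3p}`. -/
noncomputable def WSer (p : ℕ) : PowerSeries ℤ := PowerSeries.mk fun n => wPer p (n % (3 * p))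

lemma expand_three (p : ℕ) (hp : p.Prime) (h3 : 3 < p) :
    cyclotomic (3 * p) ℤ * (1 + X + X ^ 2) = 1 + X ^ p + X ^ (2 * p) := by
  have hnd : ¬ p ∣ 3 := fun h => by have := Nat.le_of_dvd (by norm_num) h; omega
  have h := cyclotomic_expand_eq_cyclotomic_mul hp hnd ℤ
  have e3 : cyclotomic 3 ℤ = 1 + X + X ^ 2 := by rw [cyclotomic_three]; ring
  rw [e3] at h
  rw [← h]
  simp only [map_add, map_one, map_pow, expand_X]
  ring

lemma A_coeff (p : ℕ) (hp : p.Prime) (h3 : 3 < p) (j : ℕ) (hj : j < p) :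
    (cyclotomic (3 * p) ℤ).coeff j = if j % 3 = 0 then 1 else if j % 3 = 1 then -1 else 0 := by
  have h := expand_three p hp h3
  set A := cyclotomic (3 * p) ℤ with hA
  have key : ∀ n, n < p → (A * (1 + X + X ^ 2)).coeff n = if n = 0 then 1 else 0 := by
    intro n hn
    rw [h]
    simp only [coeff_add, coeff_one, coeff_X_pow]
    rw [if_neg (by omega : ¬ n = p), if_neg (by omega : ¬ n = 2 * p)]
    simp
  have ex : A * (1 + X + X ^ 2) = A + A * X + A * X ^ 2 := by ring
  rw [ex] at key
  have k0 : A.coeff 0 = 1 := by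
    have := key 0 (by omega)
    simpa [coeff_mul_X_pow'] using this
  have k1 : A.coeff 1 = -1 := by
    have := key 1 (by omega)
    simp [coeff_mul_X_pow', k0] at this
    linarith
  have k2 : ∀ n, n + 2 < p → A.coeff (n + 2) + A.coeff (n + 1) + A.coeff n = 0 := by
    intro n hn
    have := key (n + 2) hn
    simpa [coeff_mul_X_pow', coeff_mul_X] using this
  induction j using Nat.strong_induction_on with
  | _ j ih =>
    match j, hj, ih with
    | 0, _, _ => simpa using k0
    | 1, _, _ => simpa using k1
    | n + 2, hj, ih =>
      have := k2 n hj
      rw [ih n (by omega) (by omega), ih (n + 1) (by omega) (by omega)] at this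
      have : n % 3 = 0 ∨ n % 3 = 1 ∨ n % 3 = 2 := by omega
      rcases this with h0 | h0 | h0 <;> simp [Nat.add_mod, h0] at * <;> linarith

lemma WSer_mul_one_sub (p : ℕ) (h3 : 3 < p) :
    WSer p * (1 - PowerSeries.X ^ (3 * p)) =
      (1 + PowerSeries.X + PowerSeries.X ^ 2) * (1 - PowerSeries.X ^ p) := by
  have ex : ((1 + PowerSeries.X + PowerSeries.X ^ 2) * (1 - PowerSeries.X ^ p) : PowerSeries ℤ)
    = PowerSeries.X ^ 0 + PowerSeries.X ^ 1 + PowerSeries.X ^ 2 - PowerSeries.X ^ p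
      - PowerSeries.X ^ (p + 1) - PowerSeries.X ^ (p + 2) := by ring
  rw [ex, mul_sub, mul_one]
  ext n
  simp only [map_sub, map_add, PowerSeries.coeff_mul_X_pow', PowerSeries.coeff_X_pow, WSer,
    PowerSeries.coeff_mk]
  by_cases hn : 3 * p ≤ n
  · rw [if_pos hn, ← Nat.mod_eq_sub_mod hn, sub_self]
    rw [if_neg (by omega), if_neg (by omega), if_neg (by omega), if_neg (by omega),
      if_neg (by omega), if_neg (by omega)]
    simp
  · rw [if_neg hn, Nat.mod_eq_of_lt (by omega)]
    unfold wPer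
    split_ifs <;> omega

lemma WSer_mul_cyc (p : ℕ) (hp : p.Prime) (h3 : 3 < p) :
    ((cyclotomic (3 * p) ℤ : ℤ[X]) : PowerSeries ℤ) * WSer p = 1 := by
  have h := congrArg (fun f : ℤ[X] => (f : PowerSeries ℤ)) (expand_three p hp h3)
  simp only [Polynomial.coe_mul, Polynomial.coe_add, Polynomial.coe_one, Polynomial.coe_X,
    Polynomial.coe_pow] at h
  have h2 := WSer_mul_one_sub p h3
  have hne : (1 - PowerSeries.X ^ (3 * p) : PowerSeries ℤ) ≠ 0 := by
    intro h0
    have := congrArg (PowerSeries.coeff 0) h0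
    rw [map_sub, PowerSeries.coeff_X_pow, if_neg (by omega)] at this
    simp at this
  apply mul_right_cancel₀ hne
  rw [mul_assoc, h2, ← mul_assoc, h]
  ring

lemma coeff_big (p₂ p₃ : ℕ) (hp₂ : p₂.Prime) (h3 : 3 < p₂) (hp₃ : p₃.Prime)
    (hgt : 3 * p₂ < p₃) (i k : ℕ) (hk : k < p₃) :
    (cyclotomic (3 * p₂ * p₃) ℤ).coeff (i * p₃ + k) =
      ∑ j ∈ Finset.range (i + 1), (cyclotomic (3 * p₂) ℤ).coeff j *
        wPer p₂ (((i - j) * p₃ + k) % (3 * p₂)) := by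
  have hnd : ¬ p₃ ∣ 3 * p₂ := fun h => by have := Nat.le_of_dvd (by omega) h; omega
  have h := cyclotomic_expand_eq_cyclotomic_mul hp₃ hnd ℤ
  set A := cyclotomic (3 * p₂) ℤ with hA
  set B := cyclotomic (3 * p₂ * p₃) ℤ with hB
  have hW := WSer_mul_cyc p₂ hp₂ h3
  have hBW : (B : PowerSeries ℤ) = ((expand ℤ p₃ A : ℤ[X]) : PowerSeries ℤ) * WSer p₂ := by
    rw [h, Polynomial.coe_mul, mul_assoc, hW, mul_one]
  have hsum : expand ℤ p₃ A =
      ∑ j ∈ Finset.range (A.natDegree + 1 + (i + 1)), C (A.coeff j) * X ^ (p₃ * j) := by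
    conv_lhs => rw [A.as_sum_range' (A.natDegree + 1 + (i + 1)) (by omega)]
    simp only [map_sum, expand_monomial, ← C_mul_X_pow_eq_monomial]
    simp [pow_mul]
  rw [← Polynomial.coeff_coe, hBW, hsum]
  have hc : ((∑ j ∈ Finset.range (A.natDegree + 1 + (i + 1)), C (A.coeff j) * X ^ (p₃ * j) : ℤ[X])
      : PowerSeries ℤ) = ∑ j ∈ Finset.range (A.natDegree + 1 + (i + 1)),
        PowerSeries.C (A.coeff j) * PowerSeries.X ^ (p₃ * j) := by
    rw [← Polynomial.coeToPowerSeries.ringHom_apply, map_sum]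
    refine Finset.sum_congr rfl fun j _ => ?_
    rw [Polynomial.coeToPowerSeries.ringHom_apply, Polynomial.coe_mul, Polynomial.coe_C,
      Polynomial.coe_pow, Polynomial.coe_X]
  rw [hc, Finset.sum_mul, map_sum]
  have hterm : ∀ j, PowerSeries.coeff (i * p₃ + k)
      (PowerSeries.C (A.coeff j) * PowerSeries.X ^ (p₃ * j) * WSer p₂) =
      if j ≤ i then A.coeff j * wPer p₂ (((i - j) * p₃ + k) % (3 * p₂)) else 0 := by
    intro j
    rw [mul_assoc, PowerSeries.coeff_C_mul, PowerSeries.coeff_X_pow_mul']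
    by_cases hj : j ≤ i
    · obtain ⟨d, rfl⟩ := Nat.exists_eq_add_of_le hj
      have e : (j + d) * p₃ + k = p₃ * j + (d * p₃ + k) := by ring
      rw [if_pos hj, e, if_pos (by omega)]
      simp [WSer]
    · have : p₃ * (i + 1) ≤ p₃ * j := Nat.mul_le_mul_left _ (by omega)
      rw [if_neg hj, if_neg (by nlinarith), mul_zero]
  simp only [hterm]
  rw [← Finset.sum_subset (s₁ := Finset.range (i + 1))]
  · exact Finset.sum_congr rfl fun j hj => by
      rw [if_pos (by simpa [Nat.lt_succ_iff] using hj)]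
  · intro j hj
    simp only [Finset.mem_range] at *
    omega
  · intro j _ hj
    simp only [Finset.mem_range] at hj
    rw [if_neg (by omega)]

lemma sum_range_three (f : ℕ → ℤ) (u : ℕ) :
    ∑ j ∈ Finset.range (3 * u), f j =
      ∑ s ∈ Finset.range u, (f (3 * s) + f (3 * s + 1) + f (3 * s + 2)) := by
  induction u with
  | zero => simp
  | succ u ih =>
    rw [Finset.sum_range_succ, ← ih, show 3 * (u + 1) = 3 * u + 1 + 1 + 1 by ring,
      Finset.sum_range_succ, Finset.sum_range_succ, Finset.sum_range_succ]
    ring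

/-- The coefficients of the block, extended periodically. -/
def cPer (p u k : ℕ) : ℤ :=
  ∑ s ∈ Finset.range u, (wPer p ((6 * u - 6 * s + k) % (3 * p))
    - wPer p ((6 * u - 6 * s - 2 + k) % (3 * p))) + wPer p (k % (3 * p))

lemma coeff_eq_cPer (p₂ p₃ : ℕ) (hp₂ : p₂.Prime) (h3 : 3 < p₂) (hp₃ : p₃.Prime)
    (hgt : 3 * p₂ < p₃) (hmod : p₃ % (3 * p₂) = 2) (u k : ℕ) (hu : 3 * u < p₂) (hk : k < p₃) :
    (cyclotomic (3 * p₂ * p₃) ℤ).coeff (3 * u * p₃ + k) = cPer p₂ u k := by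
  have hm : ∀ d : ℕ, (d * p₃ + k) % (3 * p₂) = (2 * d + k) % (3 * p₂) := by
    intro d
    have h1 : p₃ ≡ 2 [MOD 3 * p₂] := by
      unfold Nat.ModEq; rw [hmod, Nat.mod_eq_of_lt (by omega)]
    have := (h1.mul_left d).add_right k
    rw [mul_comm 2 d]; exact this
  rw [coeff_big p₂ p₃ hp₂ h3 hp₃ hgt _ k hk, Finset.sum_range_succ, sum_range_three]
  unfold cPer
  congr 1
  · refine Finset.sum_congr rfl fun s hs => ?_
    have hs : s < u := by simpa using hs
    rw [A_coeff p₂ hp₂ h3 _ (by omega), A_coeff p₂ hp₂ h3 _ (by omega),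
      A_coeff p₂ hp₂ h3 _ (by omega), hm, hm, hm]
    rw [show 2 * (3 * u - 3 * s) = 6 * u - 6 * s by omega,
      show 2 * (3 * u - (3 * s + 1)) = 6 * u - 6 * s - 2 by omega]
    simp [Nat.add_mod]
    ring
  · rw [A_coeff p₂ hp₂ h3 _ (by omega), hm]
    simp

lemma hw_block (p₂ p₃ : ℕ) (hp₂ : p₂.Prime) (h3 : 3 < p₂) (hp₃ : p₃.Prime)
    (hgt : 3 * p₂ < p₃) (hmod : p₃ % (3 * p₂) = 2) (u : ℕ) (hu : 3 * u < p₂) :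
    hw (blockPoly (3 * p₂) p₃ (3 * u)) = Nat.count (fun k => cPer p₂ u k ≠ 0) (3 * p₂) := by
  rw [Nat.count_eq_card_filter_range]
  unfold hw
  congr 1
  ext k
  simp only [mem_support_iff, Finset.mem_filter, Finset.mem_range, blockPoly, finsetSum_coeff,
    coeff_C_mul_X_pow]
  rw [Finset.sum_ite_eq]
  by_cases hk : k < 3 * p₂
  · simp [hk, coeff_eq_cPer p₂ p₃ hp₂ h3 hp₃ hgt hmod u k hu (by omega)]
  · simp [hk]

lemma cPer_periodic (p u : ℕ) : Function.Periodic (fun k => cPer p u k ≠ 0) (3 * p) := by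
  intro k
  simp only [cPer, ← add_assoc, Nat.add_mod_right]

/-- Closed form of the coefficients of `(1 + x + x^2) g(x^2)`. -/
def hCl (u : ℕ) (e : ℤ) : ℤ :=
  if 0 ≤ e ∧ e < 6 * u then
    (if e % 6 = 0 ∨ e % 6 = 1 then 1 else if e % 6 = 3 ∨ e % 6 = 4 then -1 else 0)
  else if 6 * u ≤ e ∧ e < 6 * u + 3 then 1 else 0

def dInd (e : ℤ) : ℤ := if 0 ≤ e ∧ e < 3 then 1 else 0

lemma hCl_sum (u : ℕ) (e : ℤ) :
    ∑ s ∈ Finset.range u, (dInd (e - 6 * s) - dInd (e - 6 * s - 2)) + dInd (e - 6 * u)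
      = hCl u e := by
  induction u with
  | zero => simp only [dInd, hCl]; simp
  | succ u ih =>
    rw [Finset.sum_range_succ]
    have : ∑ s ∈ Finset.range u, (dInd (e - 6 * s) - dInd (e - 6 * s - 2))
      = hCl u e - dInd (e - 6 * u) := by rw [← ih]; ring
    rw [this]
    simp only [dInd, hCl]
    push_cast
    split_ifs <;> omega

lemma cPer_shift (p u n : ℕ) (hu : 3 * u + 5 ≤ p) (hn : n < 3 * p) :
    cPer p u (n + (3 * p - 6 * u)) = hCl u n - hCl u (n - p) := by
  have hw : ∀ (x : ℕ) (e : ℤ), (x : ℤ) = e + 3 * p → -(6 * u + 2 : ℤ) ≤ e → e < 3 * p →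
      wPer p (x % (3 * p)) = dInd e - dInd (e - p) := by
    intro x e hx h1 h2
    by_cases he : 0 ≤ e
    · have : x % (3 * p) = x - 3 * p := by
        rw [Nat.mod_eq_sub_mod (by omega), Nat.mod_eq_of_lt (by omega)]
      rw [this]
      unfold wPer dInd
      split_ifs <;> omega
    · rw [Nat.mod_eq_of_lt (by omega)]
      unfold wPer dInd
      split_ifs <;> omega
  rw [← hCl_sum, ← hCl_sum]
  unfold cPer
  rw [hw (n + (3 * p - 6 * u)) (n - 6 * u) (by omega) (by omega) (by omega)]
  have : ∀ s ∈ Finset.range u, (wPer p ((6 * u - 6 * s + (n + (3 * p - 6 * u))) % (3 * p))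
    - wPer p ((6 * u - 6 * s - 2 + (n + (3 * p - 6 * u))) % (3 * p))) =
     (dInd (n - 6 * s) - dInd (n - 6 * s - 2)) - (dInd (n - p - 6 * s) - dInd (n - p - 6 * s - 2)) := by
    intro s hs
    have hs : s < u := by simpa using hs
    rw [hw _ (n - 6 * s) (by omega) (by omega) (by omega),
      hw _ (n - 6 * s - 2) (by omega) (by omega) (by omega),
      show (n - 6 * s - p : ℤ) = n - p - 6 * s by ring,
      show (n - 6 * s - 2 - p : ℤ) = n - p - 6 * s - 2 by ring]
    ring
  rw [Finset.sum_congr rfl this, Finset.sum_sub_distrib,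
    show (n - 6 * u - p : ℤ) = n - p - 6 * u by ring]
  ring

lemma count_shift (p u : ℕ) (hu : 3 * u + 5 ≤ p) :
    Nat.count (fun k => cPer p u k ≠ 0) (3 * p) =
      Nat.count (fun n : ℕ => hCl u n - hCl u (n - p) ≠ 0) (3 * p) := by
  rw [← Nat.filter_Ico_card_eq_of_periodic (3 * p - 6 * u) (3 * p) _ (cPer_periodic p u),
    Nat.count_eq_card_filter_range]
  symm
  apply Finset.card_bij (fun n _ => n + (3 * p - 6 * u))
  · intro n hn
    simp only [Finset.mem_filter, Finset.mem_range, Finset.mem_Ico] at *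
    rw [cPer_shift p u n hu hn.1]
    exact ⟨by omega, hn.2⟩
  · intro a _ b _ h
    simpa using h
  · intro k hk
    simp only [Finset.mem_filter, Finset.mem_range, Finset.mem_Ico] at *
    refine ⟨k - (3 * p - 6 * u), ⟨by omega, ?_⟩, by omega⟩
    rw [← cPer_shift p u _ hu (by omega), Nat.sub_add_cancel hk.1.1]
    exact hk.2

lemma count_congr_lt (P Q : ℕ → Prop) [DecidablePred P] [DecidablePred Q] (n : ℕ)
    (h : ∀ k < n, P k ↔ Q k) : Nat.count P n = Nat.count Q n := by
  rw [Nat.count_eq_card_filter_range, Nat.count_eq_card_filter_range]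
  congr 1
  exact Finset.filter_congr fun k hk => h k (by simpa using hk)

lemma count_pat (f : ℕ → Prop) [DecidablePred f] (r b : ℕ) :
    Nat.count (fun n => f (n % 6)) (6 * r + b) =
      r * Nat.count (fun n => f (n % 6)) 6 + Nat.count (fun n => f (n % 6)) b := by
  induction r with
  | zero => simp
  | succ r ih =>
    rw [show 6 * (r + 1) + b = 6 + (6 * r + b) by ring, Nat.count_add]
    simp only [Nat.add_mod_left]
    rw [ih]; ring

lemma count_const (P : ℕ → Prop) [DecidablePred P] (f : ℕ → Prop) [DecidablePred f] (r b n c d : ℕ)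
    (hn : n = 6 * r + b) (h : ∀ k < n, P k ↔ f (k % 6))
    (hc : Nat.count (fun n => f (n % 6)) 6 = c) (hd : Nat.count (fun n => f (n % 6)) b = d) :
    Nat.count P n = r * c + d := by
  rw [count_congr_lt P (fun k => f (k % 6)) n h, hn, count_pat, hc, hd]

lemma count_all (P : ℕ → Prop) [DecidablePred P] (n : ℕ) (h : ∀ k < n, P k) :
    Nat.count P n = n := by
  rw [count_congr_lt P (fun _ => True) n (fun k hk => by simp [h k hk])]; simp

lemma count_none (P : ℕ → Prop) [DecidablePred P] (n : ℕ) (h : ∀ k < n, ¬ P k) :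
    Nat.count P n = 0 := by
  rw [count_congr_lt P (fun _ => False) n (fun k hk => by simp [h k hk])]; simp

lemma case_one (p u r : ℕ) (hp : p = 6 * r + 5) (hu : u ≤ r) :
    Nat.count (fun n : ℕ => hCl u n - hCl u (n - p) ≠ 0) (3 * p) = 8 * u + 6 := by
  rw [show 3 * p = 6 * u + (3 + ((p - (6 * u + 3)) + (6 * u + (3 + (2 * p - (6 * u + 3)))))) by omega]
  simp only [Nat.count_add]
  rw [count_const _ (fun k => k ≠ 2 ∧ k ≠ 5) u 0 (6 * u) 4 0 rfl _ (by decide) (by decide),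
    count_all _ 3, count_none,
    count_const _ (fun k => k ≠ 2 ∧ k ≠ 5) u 0 (6 * u) 4 0 rfl _ (by decide) (by decide),
    count_all _ 3, count_none]
  · ring
  all_goals
    intro k hk
    unfold hCl
    subst hp
    push_cast
    split_ifs <;> omega

lemma case_two (p u r : ℕ) (hp : p = 6 * r + 5) (hu : r + 1 ≤ u) (hu2 : u ≤ 2 * r) :
    Nat.count (fun n : ℕ => hCl u n - hCl u (n - p) ≠ 0) (3 * p) = 4 * u + 4 * r + 7 := by
  obtain ⟨v, rfl⟩ := Nat.exists_eq_add_of_le hu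
  obtain ⟨N, hN⟩ : ∃ N, N = 6 * r + 5 := ⟨_, rfl⟩
  obtain ⟨K, hK⟩ : ∃ K, K = 6 * r + 4 := ⟨_, rfl⟩
  obtain ⟨M, hM⟩ : ∃ M, M = 6 * v + 1 := ⟨_, rfl⟩
  rw [show 3 * p = N + (M + (1 + (2 + (K + (1 + (3 * p - (12 * r + 6 * v + 14))))))) by omega]
  simp only [Nat.count_add]
  rw [count_const _ (fun k => k ≠ 2 ∧ k ≠ 5) r 5 N 4 4 hN _ (by decide) (by decide),
    count_const _ (fun k => k ≠ 1 ∧ k ≠ 4) v 1 M 4 1 hM _ (by decide) (by decide),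
    count_none _ 1, count_all _ 2,
    count_const _ (fun k => k ≠ 1 ∧ k ≠ 4) r 4 K 4 3 hK _ (by decide) (by decide),
    count_all _ 1,
    count_none]
  · ring
  all_goals
    intro k hk
    unfold hCl
    subst hp hN hM hK
    push_cast
    split_ifs <;> omega

theorem stmt18 (p₂ p₃ q₂ : ℕ) (hp₂ : p₂.Prime) (h3 : 3 < p₂) (hq₂ : 3 * q₂ + 2 = p₂)
    (hp₃ : p₃.Prime) (hgt : 3 * p₂ < p₃) (hmod : p₃ % (3 * p₂) = 2)
    (u i : ℕ) (hiv : i = 3 * u) (hi : i < p₂ - 1) :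
    (u ≤ (q₂ - 1) / 2 → hw (blockPoly (3 * p₂) p₃ i) = 8 * u + 6) ∧
    ((q₂ + 1) / 2 ≤ u → u ≤ q₂ - 1 →
      hw (blockPoly (3 * p₂) p₃ i) = 4 * u + 2 * q₂ + 5) := by
  subst hiv
  have hodd := hp₂.eq_two_or_odd
  obtain ⟨r, rfl⟩ : ∃ r, q₂ = 2 * r + 1 := ⟨q₂ / 2, by omega⟩
  rw [hw_block p₂ p₃ hp₂ h3 hp₃ hgt hmod u (by omega)]
  constructor
  · intro h
    rw [count_shift p₂ u (by omega), case_one p₂ u r (by omega) (by omega)]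
  · intro h h'
    rw [count_shift p₂ u (by omega), case_two p₂ u r (by omega) (by omega) (by omega)]
    ring
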